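/- Suppose n_i/2 ≥ a_i ≥ 1 for all i = 1,…,m, a· ≥ α ≥ 1, and α < n·/2. Then for every parameter λ (all λ_{i,j} > 0), R^KL(λ̂^{(α;a)}, λ) < R^KL(λ̂^J, λ); that is, under the entropy loss the stick-breaking Bayes estimator λ̂^{(α;a)}(X,Y) strictly dominates the Bayes estimator λ̂^J(X,Y) associated with the Jeffreys prior. -/

import Mathlib

open scoped BigOperators ENNReal

/-- The Poisson(μ) probability of the value `k`. -/
noncomputable def poissonPmf (mu : ℝ) (k : ℕ) : ℝ :=
  mu ^ k * Real.exp (-mu) / (Nat.factorial k)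

/-- Joint pmf of the multi-group observations: the X_{i,j} ~ Po(λ_{i,j}) and the
Y_i ~ Po(λ_{i·}) are all independent. -/
noncomputable def jointPmf2 (m : ℕ) (n : Fin m → ℕ) (lam : (i : Fin m) → Fin (n i) → ℝ)
    (x : (i : Fin m) → Fin (n i) → ℕ) (y : Fin m → ℕ) : ℝ :=
  ∏ i, (poissonPmf (∑ j, lam i j) (y i) * ∏ j, poissonPmf (lam i j) (x i j))

/-- Entropy (Kullback–Leibler) loss of an estimate d of λ. -/
noncomputable def lossKL (m : ℕ) (n : Fin m → ℕ) (d : (i : Fin m) → Fin (n i) → ℝ)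
    (lam : (i : Fin m) → Fin (n i) → ℝ) : ℝ :=
  ∑ i, ∑ j, (d i j - lam i j - lam i j * Real.log (d i j / lam i j))

/-- Entropy risk R^KL(δ, λ), valued in [0,∞]. -/
noncomputable def riskKL (m : ℕ) (n : Fin m → ℕ)
    (δ : ((i : Fin m) → Fin (n i) → ℕ) → (Fin m → ℕ) → (i : Fin m) → Fin (n i) → ℝ)
    (lam : (i : Fin m) → Fin (n i) → ℝ) : ℝ≥0∞ :=
  ∑' x : (i : Fin m) → Fin (n i) → ℕ, ∑' y : Fin m → ℕ,
    ENNReal.ofReal (lossKL m n (δ x y) lam * jointPmf2 m n lam x y)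

/-- The stick-breaking Bayes estimator λ̂^{(α;a)}_{i,j}(X,Y) =
((X··+Y·+α)/2)·((X_{i·}+Y_i+a_i)/(X··+Y·+a·))·((X_{i,j}+1/2)/(X_{i·}+n_i/2)). -/
noncomputable def estAA (m : ℕ) (n : Fin m → ℕ) (α : ℝ) (a : Fin m → ℝ)
    (x : (i : Fin m) → Fin (n i) → ℕ) (y : Fin m → ℕ) (i : Fin m) (j : Fin (n i)) : ℝ :=
  ((∑ k, ∑ l, (x k l : ℝ)) + (∑ k, (y k : ℝ)) + α) / 2 *
    (((∑ k, (x i k : ℝ)) + (y i : ℝ) + a i) /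
      ((∑ k, ∑ l, (x k l : ℝ)) + (∑ k, (y k : ℝ)) + ∑ k, a k)) *
    (((x i j : ℝ) + 1 / 2) / ((∑ k, (x i k : ℝ)) + (n i : ℝ) / 2))

lemma poissonPmf_pos {μ : ℝ} (hμ : 0 < μ) (k : ℕ) : 0 < poissonPmf μ k := by
  unfold poissonPmf
  positivity

lemma succ_mul_poissonPmf_succ (μ : ℝ) (k : ℕ) :
    ((k : ℝ) + 1) * poissonPmf μ (k + 1) = μ * poissonPmf μ k := by
  unfold poissonPmf
  rw [Nat.factorial_succ, Nat.cast_mul, pow_succ, Nat.cast_succ]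
  field_simp

/-- Joint probability mass function of independent Poisson variables, valued in `[0, ∞]`. -/
noncomputable def poissonPiPmf {ι : Type*} [Fintype ι] (θ : ι → ℝ) (ω : ι → ℕ) : ℝ≥0∞ :=
  ENNReal.ofReal (∏ k, poissonPmf (θ k) (ω k))

section PoissonPi

variable {ι : Type*} [Fintype ι] {θ : ι → ℝ}

lemma poissonPiPmf_pos (hθ : ∀ k, 0 < θ k) (ω : ι → ℕ) : 0 < poissonPiPmf θ ω :=
  ENNReal.ofReal_pos.2 (Finset.prod_pos fun k _ => poissonPmf_pos (hθ k) _)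

lemma tsum_poissonPiPmf (hθ : ∀ k, 0 < θ k) : ∑' ω, poissonPiPmf θ ω = 1 := by
  have key : ∀ ω, poissonPiPmf θ ω = MeasureTheory.Measure.pi
      (fun k => ProbabilityTheory.poissonMeasure (θ k).toNNReal) {ω} := by
    intro ω
    rw [MeasureTheory.Measure.pi_singleton, poissonPiPmf,
      ENNReal.ofReal_prod_of_nonneg fun k _ => (poissonPmf_pos (hθ k) _).le]
    refine Finset.prod_congr rfl fun k _ => ?_
    rw [ProbabilityTheory.poissonMeasure_singleton, Real.coe_toNNReal _ (hθ k).le, poissonPmf,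
      mul_comm (Real.exp _)]
  simp_rw [key]
  have h := MeasureTheory.Measure.tsum_indicator_apply_singleton (MeasureTheory.Measure.pi
      (fun k => ProbabilityTheory.poissonMeasure (θ k).toNNReal)) Set.univ MeasurableSet.univ
  simpa using h

variable [DecidableEq ι]

lemma succ_mul_poissonPiPmf_add_single (hθ : ∀ k, 0 < θ k) (k : ι) (ω : ι → ℕ) :
    ((ω k : ℝ≥0∞) + 1) * poissonPiPmf θ (ω + Pi.single k 1) =
      ENNReal.ofReal (θ k) * poissonPiPmf θ ω := by
  have h1 : ((ω k : ℝ≥0∞) + 1) = ENNReal.ofReal ((ω k : ℝ) + 1) := by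
    rw [ENNReal.ofReal_add (by positivity) zero_le_one]
    simp
  rw [h1, poissonPiPmf, poissonPiPmf, ← ENNReal.ofReal_mul (by positivity),
    ← ENNReal.ofReal_mul (hθ k).le, ← Finset.mul_prod_erase _ _ (Finset.mem_univ k),
    ← Finset.mul_prod_erase _ _ (Finset.mem_univ k), ← mul_assoc, ← mul_assoc]
  congr 2
  · simpa using succ_mul_poissonPmf_succ (θ k) (ω k)
  · refine Finset.prod_congr rfl fun l hl => ?_
    simp [Finset.ne_of_mem_erase hl]

/-- The Stein identity of the Poisson distribution, in one coordinate. -/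
lemma tsum_apply_mul_poissonPiPmf (hθ : ∀ k, 0 < θ k) (k : ι) (f : (ι → ℕ) → ℝ≥0∞) :
    ∑' ω, ω k * f ω * poissonPiPmf θ ω =
      ENNReal.ofReal (θ k) * ∑' ω, f (ω + Pi.single k 1) * poissonPiPmf θ ω := by
  have hinj : Function.Injective fun ω : ι → ℕ => ω + Pi.single k 1 := add_left_injective _
  rw [← hinj.tsum_eq, ← ENNReal.tsum_mul_left]
  · refine tsum_congr fun ω => ?_
    have := succ_mul_poissonPiPmf_add_single hθ k ω
    rw [mul_left_comm, ← this]
    simp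
    ring
  · intro ω hω
    have hk : ω k ≠ 0 := fun h => hω (by simp [h])
    refine ⟨ω - Pi.single k 1, funext fun l => ?_⟩
    obtain rfl | hl := eq_or_ne l k
    · simp
      omega
    · simp [hl]

lemma tsum_apply_mul_poissonPiPmf_eq (hθ : ∀ k, 0 < θ k) (k : ι) :
    ∑' ω, (ω k : ℝ≥0∞) * poissonPiPmf θ ω = ENNReal.ofReal (θ k) := by
  simpa [tsum_poissonPiPmf hθ] using tsum_apply_mul_poissonPiPmf hθ k 1

/-- For `Z` a Poisson variable with mean `μ`, `μ * E[1 / (Z + 1)] < 1`. -/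
lemma sum_mul_tsum_inv_lt_one (hθ : ∀ k, 0 < θ k) (S : Finset ι) :
    ENNReal.ofReal (∑ k ∈ S, θ k) *
      ∑' ω, ((∑ k ∈ S, (ω k : ℝ≥0∞)) + 1)⁻¹ * poissonPiPmf θ ω < 1 := by
  have hshift : ∀ k ∈ S, ∀ ω : ι → ℕ,
      ∑ l ∈ S, (((ω + Pi.single k 1 : ι → ℕ) l : ℕ) : ℝ≥0∞) = (∑ l ∈ S, (ω l : ℝ≥0∞)) + 1 := by
    intro k hk ω
    simp [Finset.sum_add_distrib, Pi.single_apply, hk]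
  have h : ENNReal.ofReal (∑ k ∈ S, θ k) *
      ∑' ω, ((∑ k ∈ S, (ω k : ℝ≥0∞)) + 1)⁻¹ * poissonPiPmf θ ω =
      ∑' ω, (∑ k ∈ S, (ω k : ℝ≥0∞)) * (∑ k ∈ S, (ω k : ℝ≥0∞))⁻¹ * poissonPiPmf θ ω := by
    rw [ENNReal.ofReal_sum_of_nonneg fun k _ => (hθ k).le, Finset.sum_mul]
    simp_rw [Finset.sum_mul]
    rw [Summable.tsum_finsetSum fun _ _ => ENNReal.summable]
    refine Finset.sum_congr rfl fun k hk => ?_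
    rw [tsum_apply_mul_poissonPiPmf hθ k fun ω => (∑ k ∈ S, (ω k : ℝ≥0∞))⁻¹]
    refine congrArg _ (tsum_congr fun ω => ?_)
    rw [hshift k hk]
  rw [h, ← tsum_poissonPiPmf hθ]
  have hle : ∀ ω, (∑ k ∈ S, (ω k : ℝ≥0∞)) * (∑ k ∈ S, (ω k : ℝ≥0∞))⁻¹ * poissonPiPmf θ ω ≤
      poissonPiPmf θ ω := fun ω =>
    mul_le_of_le_one_left' (ENNReal.mul_inv_le_one _)
  refine ENNReal.tsum_lt_tsum (i := 0) ?_ hle ?_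
  · refine ne_top_of_le_ne_top ?_ (ENNReal.tsum_le_tsum hle)
    simp [tsum_poissonPiPmf hθ]
  · simpa using poissonPiPmf_pos hθ 0

lemma tsum_sum_div_lt (hθ : ∀ k, 0 < θ k) {κ : Type*} [Fintype κ] {A : κ → ℝ}
    (hA : ∀ k, 0 ≤ A k) (hA' : 0 < ∑ k, A k) (S : κ → Finset ι) :
    ∑' ω, ENNReal.ofReal (∑ k, A k * ((∑ l ∈ S k, θ l) / ((∑ l ∈ S k, (ω l : ℝ)) + 1))) *
      poissonPiPmf θ ω < ENNReal.ofReal (∑ k, A k) := by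
  set Q : κ → ℝ≥0∞ := fun k => ENNReal.ofReal (∑ l ∈ S k, θ l) *
      ∑' ω, ((∑ l ∈ S k, (ω l : ℝ≥0∞)) + 1)⁻¹ * poissonPiPmf θ ω with hQ
  have hterm : ∀ k (ω : ι → ℕ),
      ENNReal.ofReal (A k * ((∑ l ∈ S k, θ l) / ((∑ l ∈ S k, (ω l : ℝ)) + 1))) =
      ENNReal.ofReal (A k) * (ENNReal.ofReal (∑ l ∈ S k, θ l) *
        ((∑ l ∈ S k, (ω l : ℝ≥0∞)) + 1)⁻¹) := by
    intro k ω
    have hpos : (0 : ℝ) < (∑ l ∈ S k, (ω l : ℝ)) + 1 := by positivity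
    rw [ENNReal.ofReal_mul (hA k), ENNReal.ofReal_div_of_pos hpos, ENNReal.div_eq_inv_mul,
      ENNReal.ofReal_add (by positivity) zero_le_one,
      ENNReal.ofReal_sum_of_nonneg fun _ _ => by positivity, mul_comm (_⁻¹)]
    simp
  have hsum : ∑' ω, ENNReal.ofReal
      (∑ k, A k * ((∑ l ∈ S k, θ l) / ((∑ l ∈ S k, (ω l : ℝ)) + 1))) * poissonPiPmf θ ω =
      ∑ k, ENNReal.ofReal (A k) * Q k := by
    simp_rw [hQ, ← ENNReal.tsum_mul_left]
    rw [← Summable.tsum_finsetSum fun _ _ => ENNReal.summable]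
    refine tsum_congr fun ω => ?_
    rw [ENNReal.ofReal_sum_of_nonneg, Finset.sum_mul]
    · refine Finset.sum_congr rfl fun k _ => ?_
      rw [hterm]
      ring
    · intro k _
      have := Finset.sum_nonneg fun l (_ : l ∈ S k) => (hθ l).le
      have := hA k
      positivity
  have hq : Finset.univ.sup Q < 1 :=
    (Finset.sup_lt_iff (by simp)).2 fun k _ => sum_mul_tsum_inv_lt_one hθ (S k)
  calc _ = ∑ k, ENNReal.ofReal (A k) * Q k := hsum
    _ ≤ ∑ k, ENNReal.ofReal (A k) * Finset.univ.sup Q := by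
      gcongr with k
      exact Finset.le_sup (Finset.mem_univ k)
    _ = ENNReal.ofReal (∑ k, A k) * Finset.univ.sup Q := by
      rw [← Finset.sum_mul, ENNReal.ofReal_sum_of_nonneg fun k _ => hA k]
    _ < ENNReal.ofReal (∑ k, A k) * 1 :=
      ENNReal.mul_lt_mul_right (ENNReal.ofReal_pos.2 hA').ne' ENNReal.ofReal_ne_top hq
    _ = _ := mul_one _

end PoissonPi

lemma log_div_le_div {z a b : ℝ} (hz : 0 ≤ z) (ha : 1 ≤ a) (hab : a ≤ b) :
    Real.log ((z + b) / (z + a)) ≤ (b - a) / (z + 1) := by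
  have hza : 0 < z + a := by linarith
  calc Real.log ((z + b) / (z + a)) ≤ (z + b) / (z + a) - 1 :=
        Real.log_le_sub_one_of_pos (div_pos (by linarith) hza)
    _ = (b - a) / (z + a) := by
      rw [div_sub_one hza.ne', add_sub_add_left_eq_sub]
    _ ≤ (b - a) / (z + 1) := by gcongr

section Estimator

variable {m : ℕ} {n : Fin m → ℕ} {α : ℝ} {a : Fin m → ℝ}
  {x : (i : Fin m) → Fin (n i) → ℕ} {y : Fin m → ℕ}

lemma estAA_pos (hn : ∀ i, 1 ≤ n i) (hα : 0 < α) (ha : ∀ i, 0 < a i) (i : Fin m)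
    (j : Fin (n i)) : 0 < estAA m n α a x y i j := by
  have h1 : (0 : ℝ) < n i := by exact_mod_cast hn i
  have h2 : 0 < ∑ k, a k := Finset.sum_pos (fun k _ => ha k) ⟨i, Finset.mem_univ i⟩
  have h3 := ha i
  unfold estAA
  positivity

lemma sum_estAA (hm : 1 ≤ m) (hn : ∀ i, 1 ≤ n i) (ha : ∀ i, 0 < a i) :
    ∑ i, ∑ j, estAA m n α a x y i j =
      ((∑ k, ∑ l, (x k l : ℝ)) + (∑ k, (y k : ℝ)) + α) / 2 := by
  have hA : 0 < ∑ k, a k := Finset.sum_pos (fun k _ => ha k) ⟨⟨0, hm⟩, Finset.mem_univ _⟩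
  have hi : ∀ i, ∑ j, ((x i j : ℝ) + 1 / 2) / ((∑ k, (x i k : ℝ)) + (n i : ℝ) / 2) = 1 := by
    intro i
    have h1 : (0 : ℝ) < n i := by exact_mod_cast hn i
    rw [← Finset.sum_div, Finset.sum_add_distrib, Finset.sum_const, Finset.card_univ,
      Fintype.card_fin, nsmul_eq_mul, mul_one_div]
    exact div_self (by positivity)
  unfold estAA
  simp_rw [← Finset.mul_sum, hi, mul_one, ← Finset.mul_sum, ← Finset.sum_div,
    Finset.sum_add_distrib]
  rw [div_self (by positivity), mul_one]

lemma le_estAA (hn : ∀ i, 1 ≤ n i) (hα : 0 < α) (ha : ∀ i, 0 < a i)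
    (ha' : ∀ i, a i ≤ (n i : ℝ) / 2) (hα' : α ≤ ∑ i, a i) (i : Fin m) (j : Fin (n i)) :
    α / (∑ k, a k) * (a i / ((n i : ℝ) / 2)) / 4 ≤ estAA m n α a x y i j := by
  have h1 : (0 : ℝ) < n i := by exact_mod_cast hn i
  have hA : 0 < ∑ k, a k := hα.trans_le hα'
  have hi := ha i
  have hi' := ha' i
  unfold estAA
  set T : ℝ := (∑ k, ∑ l, (x k l : ℝ)) + ∑ k, (y k : ℝ) with hT
  set s : ℝ := ∑ k, (x i k : ℝ) with hs
  have hT0 : 0 ≤ T := by positivity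
  have hs0 : 0 ≤ s := by positivity
  have hx : (0 : ℝ) ≤ x i j := by positivity
  have hy : (0 : ℝ) ≤ y i := by positivity
  have e1 : α / (∑ k, a k) ≤ (T + α) / (T + ∑ k, a k) := by
    rw [div_le_div_iff₀ hA (by positivity)]
    nlinarith
  have e2 : a i / ((n i : ℝ) / 2) ≤ (s + y i + a i) / (s + (n i : ℝ) / 2) := by
    rw [div_le_div_iff₀ (by positivity) (by positivity)]
    nlinarith
  calc α / (∑ k, a k) * (a i / ((n i : ℝ) / 2)) / 4
      = α / (∑ k, a k) * (a i / ((n i : ℝ) / 2)) * (1 / 2) * (1 / 2) := by ring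
    _ ≤ (T + α) / (T + ∑ k, a k) * ((s + y i + a i) / (s + (n i : ℝ) / 2)) *
        (x i j + 1 / 2) * (1 / 2) := by
      gcongr
      linarith
    _ = _ := by
      field_simp

/-- Pointwise bound on the log-ratio of the Jeffreys-prior estimator and `estAA`. -/
lemma log_estAA_jeffreys_sub_log_estAA_le (hn : ∀ i, 1 ≤ n i) (hα : 1 ≤ α) (ha : ∀ i, 1 ≤ a i)
    (ha' : ∀ i, a i ≤ (n i : ℝ) / 2) (hα' : α ≤ ∑ i, a i) (i : Fin m) (j : Fin (n i)) :
    Real.log (estAA m n ((∑ i, (n i : ℝ)) / 2) (fun i => (n i : ℝ) / 2) x y i j) -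
        Real.log (estAA m n α a x y i j) ≤
      ((n i : ℝ) / 2 - a i) / ((∑ k, (x i k : ℝ)) + y i + 1) +
        ((∑ k, a k) - α) / ((∑ k, ∑ l, (x k l : ℝ)) + (∑ k, (y k : ℝ)) + 1) := by
  have h1 : (0 : ℝ) < n i := by exact_mod_cast hn i
  have hN : (0 : ℝ) < ∑ k, (n k : ℝ) :=
    Finset.sum_pos (fun k _ => by exact_mod_cast hn k) ⟨i, Finset.mem_univ i⟩
  have hi := ha i
  have hα0 : 0 < α := by linarith
  have hd : 0 < estAA m n α a x y i j :=
    estAA_pos hn hα0 (fun k => zero_lt_one.trans_le (ha k)) i j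
  have he : 0 < estAA m n ((∑ i, (n i : ℝ)) / 2) (fun i => (n i : ℝ) / 2) x y i j :=
    estAA_pos hn (by positivity) (fun k => by
      have : (0 : ℝ) < n k := by exact_mod_cast hn k
      positivity) i j
  rw [← Real.log_div he.ne' hd.ne']
  unfold estAA
  set T : ℝ := (∑ k, ∑ l, (x k l : ℝ)) + ∑ k, (y k : ℝ) with hT
  set z : ℝ := (∑ k, (x i k : ℝ)) + y i with hz
  have hT0 : 0 ≤ T := by positivity
  have hz0 : 0 ≤ z := by positivity
  have hA : 0 < ∑ k, a k := by linarith
  have hratio : (T + (∑ k, (n k : ℝ)) / 2) / 2 *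
      ((z + (n i : ℝ) / 2) / (T + ∑ k, (n k : ℝ) / 2)) *
      (((x i j : ℝ) + 1 / 2) / ((∑ k, (x i k : ℝ)) + (n i : ℝ) / 2)) /
      ((T + α) / 2 * ((z + a i) / (T + ∑ k, a k)) *
      (((x i j : ℝ) + 1 / 2) / ((∑ k, (x i k : ℝ)) + (n i : ℝ) / 2))) =
      (z + (n i : ℝ) / 2) / (z + a i) * ((T + ∑ k, a k) / (T + α)) := by
    rw [mul_div_mul_right _ _ (by positivity), ← Finset.sum_div]
    field_simp
  rw [hratio, Real.log_mul (by positivity) (by positivity)]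
  exact add_le_add (log_div_le_div hz0 hi (ha' i)) (log_div_le_div hT0 hα hα')

/-- Pointwise comparison of the losses of the Jeffreys-prior estimator and of `estAA`. -/
lemma lossKL_estAA_add_le (hm : 1 ≤ m) (hn : ∀ i, 1 ≤ n i) (hα : 1 ≤ α) (ha : ∀ i, 1 ≤ a i)
    (ha' : ∀ i, a i ≤ (n i : ℝ) / 2) (hα' : α ≤ ∑ i, a i)
    {lam : (i : Fin m) → Fin (n i) → ℝ} (hlam : ∀ i j, 0 < lam i j) :
    lossKL m n (estAA m n α a x y) lam + ((∑ i, (n i : ℝ)) / 2 - α) / 2 ≤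
      lossKL m n (estAA m n ((∑ i, (n i : ℝ)) / 2) (fun i => (n i : ℝ) / 2) x y) lam +
        ∑ i, ∑ j, lam i j *
          (((n i : ℝ) / 2 - a i) / ((∑ k, (x i k : ℝ)) + y i + 1) +
            ((∑ k, a k) - α) / ((∑ k, ∑ l, (x k l : ℝ)) + (∑ k, (y k : ℝ)) + 1)) := by
  have hn0 : ∀ i, (0 : ℝ) < n i := fun i => by exact_mod_cast hn i
  have hN : (0 : ℝ) < ∑ k, (n k : ℝ) :=
    Finset.sum_pos (fun k _ => hn0 k) ⟨⟨0, hm⟩, Finset.mem_univ _⟩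
  have ha0 : ∀ i, 0 < a i := fun i => zero_lt_one.trans_le (ha i)
  have hb0 : ∀ i, 0 < (n i : ℝ) / 2 := fun i => half_pos (hn0 i)
  have hd : ∀ i j, 0 < estAA m n α a x y i j := estAA_pos hn (by linarith) ha0
  have he : ∀ i j, 0 < estAA m n ((∑ i, (n i : ℝ)) / 2) (fun i => (n i : ℝ) / 2) x y i j :=
    estAA_pos hn (half_pos hN) hb0
  have hsd := sum_estAA (x := x) (y := y) (α := α) hm hn ha0
  have hse := sum_estAA (x := x) (y := y) (α := (∑ i, (n i : ℝ)) / 2) hm hn hb0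
  have hlog := log_estAA_jeffreys_sub_log_estAA_le (x := x) (y := y) hn hα ha ha' hα'
  set d := estAA m n α a x y
  set e := estAA m n ((∑ i, (n i : ℝ)) / 2) (fun i => (n i : ℝ) / 2) x y
  have hterm : ∑ i, ∑ j, ((d i j - lam i j - lam i j * Real.log (d i j / lam i j)) -
      (d i j - e i j)) ≤ ∑ i, ∑ j, ((e i j - lam i j - lam i j * Real.log (e i j / lam i j)) +
        lam i j * (((n i : ℝ) / 2 - a i) / ((∑ k, (x i k : ℝ)) + y i + 1) +
            ((∑ k, a k) - α) / ((∑ k, ∑ l, (x k l : ℝ)) + (∑ k, (y k : ℝ)) + 1))) := by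
    refine Finset.sum_le_sum fun i _ => Finset.sum_le_sum fun j _ => ?_
    rw [Real.log_div (hd i j).ne' (hlam i j).ne', Real.log_div (he i j).ne' (hlam i j).ne']
    have := mul_le_mul_of_nonneg_left (hlog i j) (hlam i j).le
    linarith
  simp_rw [Finset.sum_add_distrib, Finset.sum_sub_distrib] at hterm
  unfold lossKL
  simp_rw [Finset.sum_sub_distrib]
  linarith

lemma lossKL_nonneg {d lam : (i : Fin m) → Fin (n i) → ℝ} (hd : ∀ i j, 0 < d i j)
    (hlam : ∀ i j, 0 < lam i j) : 0 ≤ lossKL m n d lam := by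
  refine Finset.sum_nonneg fun i _ => Finset.sum_nonneg fun j _ => ?_
  have h := mul_le_mul_of_nonneg_left
    (Real.log_le_sub_one_of_pos (div_pos (hd i j) (hlam i j))) (hlam i j).le
  rw [mul_sub, mul_div_cancel₀ _ (hlam i j).ne', mul_one] at h
  linarith

/-- The entropy loss of `estAA` grows at most linearly in the observations. -/
lemma exists_lossKL_estAA_le (hm : 1 ≤ m) (hn : ∀ i, 1 ≤ n i) (hα : 0 < α) (ha : ∀ i, 0 < a i)
    (ha' : ∀ i, a i ≤ (n i : ℝ) / 2) (hα' : α ≤ ∑ i, a i)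
    {lam : (i : Fin m) → Fin (n i) → ℝ} (hlam : ∀ i j, 0 < lam i j) :
    ∃ C : ℝ, ∀ x y, lossKL m n (estAA m n α a x y) lam ≤
      C + ((∑ k, ∑ l, (x k l : ℝ)) + ∑ k, (y k : ℝ)) := by
  set κ : Fin m → ℝ := fun i => α / (∑ k, a k) * (a i / ((n i : ℝ) / 2)) / 4
  have hκ : ∀ i, 0 < κ i := fun i => by
    have h1 : (0 : ℝ) < n i := by exact_mod_cast hn i
    have h2 := ha i
    have h3 : 0 < ∑ k, a k := hα.trans_le hα'
    positivity
  refine ⟨α / 2 - ∑ i, ∑ j, lam i j * Real.log (κ i / lam i j), fun x y => ?_⟩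
  have hterm : lossKL m n (estAA m n α a x y) lam ≤
      ∑ i, ∑ j, (estAA m n α a x y i j - lam i j * Real.log (κ i / lam i j)) := by
    refine Finset.sum_le_sum fun i _ => Finset.sum_le_sum fun j _ => ?_
    have hl := hlam i j
    have : lam i j * Real.log (κ i / lam i j) ≤
        lam i j * Real.log (estAA m n α a x y i j / lam i j) := by
      refine mul_le_mul_of_nonneg_left (Real.log_le_log (div_pos (hκ i) hl) ?_) hl.le
      gcongr
      exact le_estAA hn hα ha ha' hα' i j
    linarith
  simp_rw [Finset.sum_sub_distrib] at hterm
  rw [sum_estAA hm hn ha] at hterm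
  have hT : 0 ≤ (∑ k, ∑ l, (x k l : ℝ)) + ∑ k, (y k : ℝ) := by positivity
  linarith

/-- The rates of the observations, indexed by all the observations at once. -/
noncomputable def jointRate (lam : (i : Fin m) → Fin (n i) → ℝ) :
    (Σ i : Fin m, Fin (n i)) ⊕ Fin m → ℝ :=
  Sum.elim (fun p => lam p.1 p.2) fun i => ∑ j, lam i j

lemma jointRate_pos (hn : ∀ i, 1 ≤ n i) {lam : (i : Fin m) → Fin (n i) → ℝ}
    (hlam : ∀ i j, 0 < lam i j) (k : (Σ i : Fin m, Fin (n i)) ⊕ Fin m) :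
    0 < jointRate lam k := by
  obtain p | i := k
  · exact hlam _ _
  · exact Finset.sum_pos (fun j _ => hlam i j) ⟨⟨0, hn i⟩, Finset.mem_univ _⟩

lemma riskKL_eq_tsum (hn : ∀ i, 1 ≤ n i) {lam : (i : Fin m) → Fin (n i) → ℝ}
    (hlam : ∀ i j, 0 < lam i j)
    (δ : ((i : Fin m) → Fin (n i) → ℕ) → (Fin m → ℕ) → (i : Fin m) → Fin (n i) → ℝ) :
    riskKL m n δ lam = ∑' ω : (Σ i : Fin m, Fin (n i)) ⊕ Fin m → ℕ,
      ENNReal.ofReal (lossKL m n (δ (fun i j => ω (.inl ⟨i, j⟩)) fun i => ω (.inr i)) lam) *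
        poissonPiPmf (jointRate lam) ω := by
  have hpmf : ∀ ω : (Σ i : Fin m, Fin (n i)) ⊕ Fin m → ℕ,
      jointPmf2 m n lam (fun i j => ω (.inl ⟨i, j⟩)) (fun i => ω (.inr i)) =
        ∏ k, poissonPmf (jointRate lam k) (ω k) := by
    intro ω
    simp only [jointPmf2, jointRate, Fintype.prod_sum_type, Fintype.prod_sigma,
      Finset.prod_mul_distrib, Sum.elim_inl, Sum.elim_inr]
    exact mul_comm _ _
  let e : ((Σ i : Fin m, Fin (n i)) ⊕ Fin m → ℕ) ≃
      ((i : Fin m) → Fin (n i) → ℕ) × (Fin m → ℕ) :=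
    (Equiv.sumArrowEquivProdArrow _ _ _).trans
      ((Equiv.piCurry fun _ _ => ℕ).prodCongr (Equiv.refl _))
  rw [riskKL, ← ENNReal.tsum_prod (f := fun x y =>
    ENNReal.ofReal (lossKL m n (δ x y) lam * jointPmf2 m n lam x y)), ← e.tsum_eq]
  refine tsum_congr fun ω => ?_
  rw [poissonPiPmf, ← hpmf, ← ENNReal.ofReal_mul']
  · rfl
  · rw [hpmf]
    exact Finset.prod_nonneg fun k _ => (poissonPmf_pos (jointRate_pos hn hlam k) _).le

lemma riskKL_estAA_ne_top (hm : 1 ≤ m) (hn : ∀ i, 1 ≤ n i) (hα : 0 < α) (ha : ∀ i, 0 < a i)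
    (ha' : ∀ i, a i ≤ (n i : ℝ) / 2) (hα' : α ≤ ∑ i, a i)
    {lam : (i : Fin m) → Fin (n i) → ℝ} (hlam : ∀ i j, 0 < lam i j) :
    riskKL m n (estAA m n α a) lam ≠ ∞ := by
  obtain ⟨C, hC⟩ := exists_lossKL_estAA_le hm hn hα ha ha' hα' hlam
  have hθ := jointRate_pos hn hlam
  rw [riskKL_eq_tsum hn hlam]
  have hle : ∀ ω : (Σ i : Fin m, Fin (n i)) ⊕ Fin m → ℕ,
      ENNReal.ofReal (lossKL m n
        (estAA m n α a (fun i j => ω (.inl ⟨i, j⟩)) fun i => ω (.inr i)) lam) *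
        poissonPiPmf (jointRate lam) ω ≤
      ENNReal.ofReal C * poissonPiPmf (jointRate lam) ω +
        ∑ k, (ω k : ℝ≥0∞) * poissonPiPmf (jointRate lam) ω := by
    intro ω
    rw [← Finset.sum_mul, ← add_mul]
    gcongr
    refine (ENNReal.ofReal_le_ofReal (hC _ _)).trans (ENNReal.ofReal_add_le.trans_eq ?_)
    have hsum : (∑ k, ∑ l, (ω (.inl ⟨k, l⟩) : ℝ)) + ∑ k, (ω (.inr k) : ℝ) = ∑ k, (ω k : ℝ) := by
      rw [Fintype.sum_sum_type, Fintype.sum_sigma]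
    rw [hsum, ENNReal.ofReal_sum_of_nonneg fun _ _ => by positivity]
    simp
  refine ne_top_of_le_ne_top ?_ (ENNReal.tsum_le_tsum hle)
  rw [ENNReal.tsum_add, ENNReal.tsum_mul_left, tsum_poissonPiPmf hθ,
    Summable.tsum_finsetSum fun _ _ => ENNReal.summable]
  simp_rw [tsum_apply_mul_poissonPiPmf_eq hθ]
  simp [ENNReal.sum_eq_top]

end Estimator

/- STATEMENT 14: if n_i/2 ≥ a_i ≥ 1 for every i, a· ≥ α ≥ 1 and α < n·/2, then
under the entropy loss the stick-breaking Bayes estimator λ̂^{(α;a)} strictly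
dominates the Jeffreys-prior Bayes estimator λ̂^J = λ̂^{(n·/2;(n_1/2,…,n_m/2))}. -/
theorem stmt_14 (m : ℕ) (hm : 1 ≤ m) (n : Fin m → ℕ) (hn : ∀ i, 1 ≤ n i)
    (α : ℝ) (a : Fin m → ℝ)
    (ha1 : ∀ i, 1 ≤ a i) (ha2 : ∀ i, a i ≤ (n i : ℝ) / 2)
    (hα1 : 1 ≤ α) (hα2 : α ≤ ∑ i, a i) (hα3 : α < (∑ i, (n i : ℝ)) / 2)
    (lam : (i : Fin m) → Fin (n i) → ℝ) (hlam : ∀ i j, 0 < lam i j) :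
    riskKL m n (estAA m n α a) lam <
      riskKL m n (estAA m n ((∑ i, (n i : ℝ)) / 2) (fun i => (n i : ℝ) / 2)) lam := by
  have ha0 : ∀ i, 0 < a i := fun i => zero_lt_one.trans_le (ha1 i)
  have hθ := jointRate_pos hn hlam
  have hfin := riskKL_estAA_ne_top hm hn (zero_lt_one.trans_le hα1) ha0 ha2 hα2 hlam
  let A : Option (Fin m) → ℝ :=
    fun o => o.elim (((∑ i, a i) - α) / 2) fun i => ((n i : ℝ) / 2 - a i) / 2
  let S : Option (Fin m) → Finset ((Σ i : Fin m, Fin (n i)) ⊕ Fin m) :=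
    fun o => o.elim Finset.univ fun i =>
      (Finset.univ.map (Function.Embedding.sigmaMk (β := fun i => Fin (n i)) i)).disjSum {i}
  have hA : ∀ o, 0 ≤ A o := by
    rintro (_ | i)
    · exact div_nonneg (sub_nonneg.2 hα2) zero_le_two
    · exact div_nonneg (sub_nonneg.2 (ha2 i)) zero_le_two
  have hAsum : ∑ o, A o = ((∑ i, (n i : ℝ)) / 2 - α) / 2 := by
    simp only [A, Fintype.sum_option, Option.elim_none, Option.elim_some, ← Finset.sum_div,
      Finset.sum_sub_distrib]
    ring
  have hE := tsum_sum_div_lt hθ hA (by rw [hAsum]; linarith) S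
  have hN : ∀ ω : (Σ i : Fin m, Fin (n i)) ⊕ Fin m → ℕ,
      ∑ i, ∑ j, lam i j *
          (((n i : ℝ) / 2 - a i) / ((∑ k, (ω (.inl ⟨i, k⟩) : ℝ)) + ω (.inr i) + 1) +
            ((∑ k, a k) - α) /
              ((∑ k, ∑ l, (ω (.inl ⟨k, l⟩) : ℝ)) + (∑ k, (ω (.inr k) : ℝ)) + 1)) =
      ∑ o, A o * ((∑ l ∈ S o, jointRate lam l) / ((∑ l ∈ S o, (ω l : ℝ)) + 1)) := by
    intro ω
    simp only [A, S, jointRate, Fintype.sum_option, Option.elim_none, Option.elim_some,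
      Fintype.sum_sum_type, Fintype.sum_sigma, Finset.sum_disjSum, Finset.sum_map,
      Finset.sum_singleton, Sum.elim_inl, Sum.elim_inr, Function.Embedding.sigmaMk_apply,
      mul_add, Finset.sum_add_distrib, ← Finset.sum_mul]
    rw [add_comm]
    congr 1
    · ring
    · refine Finset.sum_congr rfl fun i _ => ?_
      have hS : ∑ l, lam (Function.Embedding.sigmaMk (β := fun i => Fin (n i)) i l).1
          (Function.Embedding.sigmaMk (β := fun i => Fin (n i)) i l).2 = ∑ j, lam i j := rfl
      rw [hS]
      ring
  rw [hAsum] at hE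
  by_contra! hle
  refine hE.not_ge (ENNReal.le_of_add_le_add_left hfin ?_)
  calc _ = riskKL m n (estAA m n α a) lam + ENNReal.ofReal (((∑ i, (n i : ℝ)) / 2 - α) / 2) *
        ∑' ω, poissonPiPmf (jointRate lam) ω := by rw [tsum_poissonPiPmf hθ, mul_one]
    _ ≤ riskKL m n (estAA m n ((∑ i, (n i : ℝ)) / 2) (fun i => (n i : ℝ) / 2)) lam +
        ∑' ω, ENNReal.ofReal
          (∑ o, A o * ((∑ l ∈ S o, jointRate lam l) / ((∑ l ∈ S o, (ω l : ℝ)) + 1))) *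
          poissonPiPmf (jointRate lam) ω := by
      rw [riskKL_eq_tsum hn hlam, riskKL_eq_tsum hn hlam, ← ENNReal.tsum_mul_left,
        ← ENNReal.tsum_add, ← ENNReal.tsum_add]
      refine ENNReal.tsum_le_tsum fun ω => ?_
      rw [← add_mul, ← add_mul]
      gcongr ?_ * _
      rw [← ENNReal.ofReal_add (lossKL_nonneg (estAA_pos hn (by linarith) ha0) hlam)
        (by linarith)]
      refine le_trans (ENNReal.ofReal_le_ofReal ?_) ENNReal.ofReal_add_le
      rw [← hN]
      exact lossKL_estAA_add_le hm hn hα1 ha1 ha2 hα2 hlam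
    _ ≤ _ := by gcongr
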